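/- arXiv:1311.2883 — 3 statements merged into one kernel-verified Lean document; each statement's English description precedes it below -/
import Mathlib

section
/- Let X be a real Banach space and a ∈ [0,∞). Let F : [0,∞) → L(X) (bounded linear operators on X) satisfy: F(0) = id; ‖F(t)‖ ≤ e^{a t} for all t ≥ 0; and for every x ∈ X the map t ↦ F(t)x is continuous on [0,∞). Let D(F'(0)) be the set of x ∈ X for which the strong limit F'(0)x := lim_{t→0+} (F(t)x − x)/t exists, and let D ⊆ D(F'(0)) be a linear subspace such that the restriction of F'(0) to D is closable, with closure the (generally unbounded) linear operator (L, D(L)). Suppose (T_t)_{t≥0} is a strongly continuous semigroup of bounded operators on X (i.e. T_0 = id, T_{s+t} = T_s T_t for all s,t ≥ 0, and t ↦ T_t x is continuous for every x ∈ X) whose generator equals (L, D(L)), i.e. D(L) = { x ∈ X : lim_{t→0+}(T_t x − x)/t exists as a strong limit } and L x equals this limit for x ∈ D(L). Then for every t₀ > 0 and every x ∈ X, (F(t/n))^n x → T_t x as n → ∞, uniformly with respect to t ∈ [0, t₀]. -/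
open Filter Topology Set

namespace Chernoff

variable {X : Type*} [NormedAddCommGroup X] [NormedSpace ℝ X]

/-- Powers of `F h` grow at most like `exp (a * (k * h))`. -/
lemma norm_pow_apply_le {a : ℝ} {F : ℝ → X →L[ℝ] X}
    (hF : ∀ t : ℝ, 0 ≤ t → ‖F t‖ ≤ Real.exp (a * t)) {h : ℝ} (hh : 0 ≤ h) (k : ℕ) (y : X) :
    ‖(F h ^ k) y‖ ≤ Real.exp (a * (k * h)) * ‖y‖ := by
  induction k with
  | zero => simp
  | succ k ih =>
    rw [pow_succ', mul_apply_eq_comp]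
    calc ‖F h ((F h ^ k) y)‖ ≤ ‖F h‖ * ‖(F h ^ k) y‖ := (F h).le_opNorm _
      _ ≤ Real.exp (a * h) * (Real.exp (a * (k * h)) * ‖y‖) := by
        gcongr
        exact hF h hh
      _ = Real.exp (a * ((k + 1 : ℕ) * h)) * ‖y‖ := by
        rw [← mul_assoc, ← Real.exp_add]
        congr 2
        push_cast
        ring

lemma norm_pow_apply_le_of_le {a : ℝ} (ha : 0 ≤ a) {F : ℝ → X →L[ℝ] X}
    (hF : ∀ t : ℝ, 0 ≤ t → ‖F t‖ ≤ Real.exp (a * t)) {h τ : ℝ} (hh : 0 ≤ h) {k : ℕ}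
    (hk : k * h ≤ τ) (y : X) :
    ‖(F h ^ k) y‖ ≤ Real.exp (a * τ) * ‖y‖ :=
  (norm_pow_apply_le hF hh k y).trans (by gcongr)

/-- Summing one-step errors of the iterates of a linear map against a linear path. -/
lemma norm_pow_apply_sub_sub_smul_le (A : X →L[ℝ] X) (d w : X) (h c : ℝ) (m : ℕ)
    (hc : ∀ j < m, ‖(A ^ j) (A d - d) - h • w‖ ≤ c) :
    ‖(A ^ m) d - d - (m * h) • w‖ ≤ m * c := by
  induction m with
  | zero => simp
  | succ m ih =>
    have e : (A ^ (m + 1)) d - d - ((m + 1 : ℕ) * h) • w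
        = ((A ^ m) d - d - (m * h) • w) + ((A ^ m) (A d - d) - h • w) := by
      rw [pow_succ, mul_apply_eq_comp, map_sub]
      push_cast
      module
    rw [e]
    calc _ ≤ m * c + c := (norm_add_le _ _).trans
          (add_le_add (ih fun j hj => hc j (by omega)) (hc m (by omega)))
      _ = _ := by push_cast; ring

/-- Strong differentiability at zero as a quantitative one-step estimate. -/
lemma exists_norm_sub_sub_smul_le {F : ℝ → X →L[ℝ] X} (hF0 : F 0 = ContinuousLinearMap.id ℝ X)
    {d w : X} (hd : Tendsto (fun t : ℝ => t⁻¹ • (F t d - d)) (𝓝[>] 0) (𝓝 w))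
    {ε : ℝ} (hε : 0 < ε) :
    ∃ η > (0 : ℝ), ∀ h : ℝ, 0 ≤ h → h ≤ η → ‖F h d - d - h • w‖ ≤ h * ε := by
  have h1 := (Metric.tendsto_nhds.1 hd) ε hε
  obtain ⟨η, hη, H⟩ := (mem_nhdsGT_iff_exists_Ioc_subset).1 h1
  refine ⟨η, hη, fun h h0 hle => ?_⟩
  rcases h0.eq_or_lt with rfl | hpos
  · simp [hF0]
  · have h2 : dist (h⁻¹ • (F h d - d)) w < ε := H ⟨hpos, hle⟩
    rw [dist_eq_norm] at h2
    have e : F h d - d - h • w = h • (h⁻¹ • (F h d - d) - w) := by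
      rw [smul_sub, smul_inv_smul₀ hpos.ne']
    rw [e, norm_smul, Real.norm_of_nonneg h0]
    gcongr

/-- The iterates of `F h` over short total times are uniformly close to the identity on compact
sets. -/
lemma exists_norm_pow_apply_sub_le {a : ℝ} (ha : 0 ≤ a) {F : ℝ → X →L[ℝ] X}
    (hF0 : F 0 = ContinuousLinearMap.id ℝ X)
    (hF : ∀ t : ℝ, 0 ≤ t → ‖F t‖ ≤ Real.exp (a * t)) {D : Set X} (hD : Dense D)
    (hder : ∀ d ∈ D, ∃ w, Tendsto (fun t : ℝ => t⁻¹ • (F t d - d)) (𝓝[>] 0) (𝓝 w))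
    {K : Set X} (hK : IsCompact K) {ε : ℝ} (hε : 0 < ε) :
    ∃ δ > (0 : ℝ), ∀ z ∈ K, ∀ h : ℝ, 0 ≤ h → ∀ j : ℕ, j * h ≤ δ → ‖(F h ^ j) z - z‖ ≤ ε := by
  refine hK.induction_on ?_ ?_ ?_ ?_
  · exact ⟨1, one_pos, by simp⟩
  · intro s t hst ht
    obtain ⟨δ, hδ, H⟩ := ht
    exact ⟨δ, hδ, fun z hz => H z (hst hz)⟩
  · intro s t hs ht
    obtain ⟨δ, hδ, H⟩ := hs
    obtain ⟨δ', hδ', H'⟩ := ht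
    refine ⟨min δ δ', lt_min hδ hδ', fun z hz h hh j hj => ?_⟩
    rcases hz with hz | hz
    · exact H z hz h hh j (hj.trans (min_le_left _ _))
    · exact H' z hz h hh j (hj.trans (min_le_right _ _))
  · intro z _
    set E := Real.exp (a * 1)
    have hE : 0 < E := Real.exp_pos _
    set r := ε / (4 * (E + 1))
    have hr : 0 < r := by positivity
    have hrE : (E + 1) * (2 * r) = ε / 2 := by
      simp only [r]
      field_simp
      ring
    obtain ⟨d, hdD, hdz⟩ := Metric.dense_iff.1 hD z r hr
    obtain ⟨w, hw⟩ := hder d hdz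
    obtain ⟨η, hη, H⟩ := exists_norm_sub_sub_smul_le hF0 hw one_pos
    set B := E * (1 + ‖w‖)
    have hB : 0 < B := by positivity
    refine ⟨Metric.ball z r, mem_nhdsWithin_of_mem_nhds (Metric.ball_mem_nhds z hr),
      min 1 (min η (ε / (2 * B))), by positivity, fun y hy h hh j hj => ?_⟩
    have hj1 : j * h ≤ 1 := hj.trans (min_le_left _ _)
    have hjη : j * h ≤ η := hj.trans ((min_le_right _ _).trans (min_le_left _ _))
    have hjB : j * h ≤ ε / (2 * B) := hj.trans ((min_le_right _ _).trans (min_le_right _ _))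
    have hyd : ‖y - d‖ ≤ 2 * r := by
      rw [← dist_eq_norm]
      have h1 : dist y z < r := hy
      have h2 : dist d z < r := hdD
      linarith [dist_triangle_right y d z]
    have h1 : ‖(F h ^ j) d - d‖ ≤ ε / 2 := by
      rcases Nat.eq_zero_or_pos j with rfl | hjpos
      · simp; positivity
      have hj' : (1 : ℝ) ≤ j := by exact_mod_cast hjpos
      have hhη : h ≤ η := by nlinarith
      have hstep : ‖F h d - d‖ ≤ h * (1 + ‖w‖) := by
        have := H h hh hhη
        calc ‖F h d - d‖ = ‖(F h d - d - h • w) + h • w‖ := by simp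
          _ ≤ h * 1 + ‖h • w‖ := (norm_add_le _ _).trans (by gcongr)
          _ = _ := by rw [norm_smul, Real.norm_of_nonneg hh]; ring
      have := norm_pow_apply_sub_sub_smul_le (F h) d 0 h (E * (h * (1 + ‖w‖))) j fun i hi => by
        rw [smul_zero, sub_zero]
        have hi' : (i : ℝ) * h ≤ 1 := by
          have : (i : ℝ) ≤ j := by exact_mod_cast hi.le
          nlinarith
        exact (norm_pow_apply_le_of_le ha hF hh hi' _).trans (by gcongr)
      rw [smul_zero, sub_zero] at this
      calc _ ≤ _ := this
        _ = j * h * B := by simp only [B]; ring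
        _ ≤ ε / (2 * B) * B := by gcongr
        _ = ε / 2 := by field_simp
    calc ‖(F h ^ j) y - y‖ = ‖(F h ^ j) (y - d) - (y - d) + ((F h ^ j) d - d)‖ := by
          rw [map_sub]; congr 1; abel
      _ ≤ (E * ‖y - d‖ + ‖y - d‖) + ε / 2 :=
        (norm_add_le _ _).trans (add_le_add ((norm_sub_le _ _).trans
          (by gcongr; exact norm_pow_apply_le_of_le ha hF hh hj1 _)) h1)
      _ = (E + 1) * ‖y - d‖ + ε / 2 := by ring
      _ ≤ (E + 1) * (2 * r) + ε / 2 := by gcongr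
      _ = ε := by rw [hrE]; ring

/-- Short-time consistency of the iterates of `F h` with the closure of its derivative, uniformly
on compact subsets of the graph. -/
lemma exists_norm_pow_apply_sub_sub_smul_le {a : ℝ} (ha : 0 ≤ a) {F : ℝ → X →L[ℝ] X}
    (hF0 : F 0 = ContinuousLinearMap.id ℝ X)
    (hF : ∀ t : ℝ, 0 ≤ t → ‖F t‖ ≤ Real.exp (a * t)) {G : Set (X × X)}
    (hD : Dense (Prod.fst '' G))
    (hder : ∀ p ∈ G, Tendsto (fun t : ℝ => t⁻¹ • (F t p.1 - p.1)) (𝓝[>] 0) (𝓝 p.2))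
    {K : Set (X × X)} (hK : IsCompact K) (hKG : K ⊆ closure G) {ε : ℝ} (hε : 0 < ε) :
    ∃ δ₀ > (0 : ℝ), ∀ δ : ℝ, 0 < δ → δ ≤ δ₀ → ∃ η > (0 : ℝ), ∀ p ∈ K, ∀ h : ℝ, 0 ≤ h → h ≤ η →
      ∀ m : ℕ, m * h ≤ δ → ‖(F h ^ m) p.1 - p.1 - (m * h) • p.2‖ ≤ δ * ε := by
  obtain ⟨δ₁, hδ₁, H₁⟩ := exists_norm_pow_apply_sub_le ha hF0 hF hD
    (by rintro _ ⟨p, hp, rfl⟩; exact ⟨p.2, hder p hp⟩) (hK.image continuous_snd)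
    (show 0 < ε / 4 by positivity)
  refine ⟨min 1 δ₁, by positivity, fun δ hδ hδle => ?_⟩
  have hδ1 : δ ≤ 1 := hδle.trans (min_le_left _ _)
  have hδδ : δ ≤ δ₁ := hδle.trans (min_le_right _ _)
  refine hK.induction_on ?_ ?_ ?_ ?_
  · exact ⟨1, one_pos, by simp⟩
  · intro s t hst ht
    obtain ⟨η, hη, H⟩ := ht
    exact ⟨η, hη, fun z hz => H z (hst hz)⟩
  · intro s t hs ht
    obtain ⟨η, hη, H⟩ := hs
    obtain ⟨η', hη', H'⟩ := ht
    refine ⟨min η η', lt_min hη hη', fun z hz h hh hhη => ?_⟩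
    rcases hz with hz | hz
    · exact H z hz h hh (hhη.trans (min_le_left _ _))
    · exact H' z hz h hh (hhη.trans (min_le_right _ _))
  · intro p hp
    set E := Real.exp (a * 1)
    have hE : 0 < E := Real.exp_pos _
    set ε₁ := ε / (10 * (E + 1))
    have hε₁ : 0 < ε₁ := by positivity
    have hε₁E : (E + 1) * ε₁ = ε / 10 := by
      simp only [ε₁]
      field_simp
    set r := δ * ε₁
    have hr : 0 < r := by positivity
    obtain ⟨q, hqG, hq⟩ := Metric.mem_closure_iff.1 (hKG hp) r hr
    obtain ⟨η, hη, H⟩ := exists_norm_sub_sub_smul_le hF0 (hder q hqG) hε₁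
    refine ⟨Metric.ball p r, mem_nhdsWithin_of_mem_nhds (Metric.ball_mem_nhds p hr),
      η, hη, fun p' hp' h hh hhη m hm => ?_⟩
    have hp'q : dist p' q ≤ 2 * r := by
      have : dist p' p < r := hp'
      linarith [dist_triangle p' p q]
    have hy : ‖p'.1 - q.1‖ ≤ 2 * r := by
      rw [← dist_eq_norm]; exact (le_max_left _ _).trans hp'q
    have hz : ‖q.2 - p'.2‖ ≤ 2 * r := by
      rw [← dist_eq_norm, dist_comm]; exact (le_max_right _ _).trans hp'q
    have hw : ‖q.2 - p.2‖ ≤ r := by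
      rw [← dist_eq_norm, dist_comm]; exact (le_max_right _ _).trans hq.le
    have hrε : r ≤ ε₁ := by simp only [r]; nlinarith
    have hcore := norm_pow_apply_sub_sub_smul_le (F h) q.1 q.2 h
      (h * (E * ε₁ + ((E + 1) * r + ε / 4))) m fun j hj => by
        have hjh : (j : ℝ) * h ≤ δ := by
          have : (j : ℝ) ≤ m := by exact_mod_cast hj.le
          nlinarith
        have e : (F h ^ j) (F h q.1 - q.1) - h • q.2
            = (F h ^ j) (F h q.1 - q.1 - h • q.2)
              + h • (((F h ^ j) (q.2 - p.2) - (q.2 - p.2)) + ((F h ^ j) p.2 - p.2)) := by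
          simp only [map_sub, map_smul]
          module
        rw [e]
        have b1 : ‖(F h ^ j) (F h q.1 - q.1 - h • q.2)‖ ≤ E * (h * ε₁) :=
          (norm_pow_apply_le_of_le ha hF hh (hjh.trans hδ1) _).trans
            (by gcongr; exact H h hh hhη)
        have b2 : ‖(F h ^ j) (q.2 - p.2) - (q.2 - p.2)‖ ≤ E * r + r :=
          (norm_sub_le _ _).trans (add_le_add
            ((norm_pow_apply_le_of_le ha hF hh (hjh.trans hδ1) _).trans (by gcongr)) hw)
        have b3 := H₁ p.2 ⟨p, hp, rfl⟩ h hh j (hjh.trans hδδ)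
        calc _ ≤ E * (h * ε₁) + h * ((E * r + r) + ε / 4) := by
              refine (norm_add_le _ _).trans (add_le_add b1 ?_)
              rw [norm_smul, Real.norm_of_nonneg hh]
              gcongr
              exact (norm_add_le _ _).trans (add_le_add b2 b3)
          _ = _ := by ring
    have hmh : 0 ≤ m * h := by positivity
    have hcore' : ‖(F h ^ m) q.1 - q.1 - (m * h) • q.2‖ ≤ δ * (E * ε₁ + (E + 1) * ε₁ + ε / 4) := by
      calc _ ≤ _ := hcore
        _ = m * h * (E * ε₁ + ((E + 1) * r + ε / 4)) := by ring
        _ ≤ δ * (E * ε₁ + ((E + 1) * ε₁ + ε / 4)) := by gcongr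
        _ = _ := by ring
    have e : (F h ^ m) p'.1 - p'.1 - (m * h) • p'.2
        = ((F h ^ m) (p'.1 - q.1) - (p'.1 - q.1)) + ((F h ^ m) q.1 - q.1 - (m * h) • q.2)
          + (m * h) • (q.2 - p'.2) := by
      rw [map_sub]
      module
    rw [e]
    calc _ ≤ (E * (2 * r) + 2 * r) + δ * (E * ε₁ + (E + 1) * ε₁ + ε / 4) + δ * (2 * r) := by
          refine norm_add₃_le.trans (add_le_add_three ?_ hcore' ?_)
          · exact (norm_sub_le _ _).trans (add_le_add
              ((norm_pow_apply_le_of_le ha hF hh (hm.trans hδ1) _).trans (by gcongr)) hy)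
          · rw [norm_smul, Real.norm_of_nonneg hmh]
            gcongr
      _ ≤ (E * (2 * r) + 2 * r) + δ * (E * ε₁ + (E + 1) * ε₁ + ε / 4) + δ * (2 * ε₁) := by
          gcongr
      _ = δ * (4 * ((E + 1) * ε₁) + ε₁ + ε / 4) := by simp only [r]; ring
      _ ≤ δ * (4 * ((E + 1) * ε₁) + (E + 1) * ε₁ + ε / 4) := by
          gcongr
          nlinarith
      _ = δ * (3 / 4 * ε) := by rw [hε₁E]; ring
      _ ≤ δ * ε := by gcongr; linarith

/-- The orbit of a vector in the domain of the generator is right differentiable. -/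
lemma hasDerivWithinAt_orbit {T : ℝ → X →L[ℝ] X}
    (hTsemi : ∀ s t : ℝ, 0 ≤ s → 0 ≤ t → T (s + t) = (T s).comp (T t))
    {y z : X} (hy : Tendsto (fun t : ℝ => t⁻¹ • (T t y - y)) (𝓝[>] 0) (𝓝 z))
    {s : ℝ} (hs : 0 ≤ s) : HasDerivWithinAt (fun r => T r y) (T s z) (Ici s) s := by
  rw [← hasDerivWithinAt_Ioi_iff_Ici, hasDerivWithinAt_iff_tendsto_slope' (by simp)]
  have h1 : Tendsto (fun r : ℝ => r - s) (𝓝[>] s) (𝓝[>] 0) := by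
    refine tendsto_nhdsWithin_iff.2 ⟨?_, ?_⟩
    · exact tendsto_nhdsWithin_of_tendsto_nhds
        (by simpa using (continuous_sub_right s).tendsto s)
    · filter_upwards [self_mem_nhdsWithin] with r hr
      exact sub_pos.2 (mem_Ioi.1 hr)
  refine (((T s).continuous.tendsto z).comp (hy.comp h1)).congr' ?_
  filter_upwards [self_mem_nhdsWithin] with r hr
  have hr' : s < r := hr
  have e : T r y = T s (T (r - s) y) := by
    rw [← ContinuousLinearMap.comp_apply, ← hTsemi s (r - s) hs (by linarith), add_sub_cancel]
  simp [slope_def_module, e]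

/-- Vectors in the domain of the generator stay in its domain along the semigroup. -/
lemma tendsto_generator_orbit {T : ℝ → X →L[ℝ] X}
    (hTsemi : ∀ s t : ℝ, 0 ≤ s → 0 ≤ t → T (s + t) = (T s).comp (T t))
    {y z : X} (hy : Tendsto (fun t : ℝ => t⁻¹ • (T t y - y)) (𝓝[>] 0) (𝓝 z))
    {s : ℝ} (hs : 0 ≤ s) :
    Tendsto (fun t : ℝ => t⁻¹ • (T t (T s y) - T s y)) (𝓝[>] 0) (𝓝 (T s z)) := by
  refine (((T s).continuous.tendsto z).comp hy).congr' ?_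
  filter_upwards [self_mem_nhdsWithin] with t ht
  have ht' : (0 : ℝ) ≤ t := le_of_lt ht
  have e : T t (T s y) = T s (T t y) := by
    rw [← ContinuousLinearMap.comp_apply, ← ContinuousLinearMap.comp_apply,
      ← hTsemi _ _ ht' hs, ← hTsemi _ _ hs ht', add_comm]
  simp [e]

/-- Uniform first-order expansion of an orbit starting in the domain of the generator. -/
lemma exists_norm_orbit_sub_sub_smul_le {T : ℝ → X →L[ℝ] X}
    (hTsemi : ∀ s t : ℝ, 0 ≤ s → 0 ≤ t → T (s + t) = (T s).comp (T t))
    (hTcont : ∀ x : X, ContinuousOn (fun t : ℝ => T t x) (Ici 0))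
    {y z : X} (hy : Tendsto (fun t : ℝ => t⁻¹ • (T t y - y)) (𝓝[>] 0) (𝓝 z))
    (t₀ : ℝ) {ε : ℝ} (hε : 0 < ε) :
    ∃ δ > 0, ∀ s ∈ Icc 0 t₀, ∀ r, 0 ≤ r → r ≤ δ →
      ‖T (s + r) y - T s y - r • T s z‖ ≤ ε * r := by
  have huc := isCompact_Icc.uniformContinuousOn_of_continuous
    ((hTcont z).mono (Icc_subset_Ici_self : Icc 0 (t₀ + 1) ⊆ Ici 0))
  obtain ⟨δ, hδ, H⟩ := Metric.uniformContinuousOn_iff_le.1 huc ε hε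
  refine ⟨min 1 δ, by positivity, fun s hs r hr hrδ => ?_⟩
  have hr1 : r ≤ 1 := hrδ.trans (min_le_left _ _)
  have hrd : r ≤ δ := hrδ.trans (min_le_right _ _)
  have key := norm_image_sub_le_of_norm_deriv_right_le_segment
    (f := fun u : ℝ => T u y - (u - s) • T s z) (f' := fun u => T u z - (1 : ℝ) • T s z)
    (a := s) (b := s + r) (C := ε) ?_ ?_ ?_ (s + r) ⟨by linarith, le_rfl⟩
  · simpa [sub_right_comm] using key
  · exact ((hTcont y).mono fun u hu => hs.1.trans hu.1).sub (by fun_prop)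
  · intro u hu
    exact (hasDerivWithinAt_orbit hTsemi hy (hs.1.trans hu.1)).sub
      ((((hasDerivAt_id u).sub_const s).smul_const _).hasDerivWithinAt)
  · intro u hu
    rw [one_smul, ← dist_eq_norm]
    refine H u ⟨hs.1.trans hu.1, by linarith [hu.2, hs.2]⟩ s ⟨hs.1, by linarith [hs.2]⟩ ?_
    rw [Real.dist_eq, abs_of_nonneg (by linarith [hu.1])]
    linarith [hu.2]

/-- The generator of a strongly continuous semigroup is densely defined. -/
lemma dense_generator_domain [CompleteSpace X] {T : ℝ → X →L[ℝ] X}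
    (hT0 : T 0 = ContinuousLinearMap.id ℝ X)
    (hTsemi : ∀ s t : ℝ, 0 ≤ s → 0 ≤ t → T (s + t) = (T s).comp (T t))
    (hTcont : ∀ x : X, ContinuousOn (fun t : ℝ => T t x) (Ici 0)) :
    Dense {x : X | ∃ y, Tendsto (fun t : ℝ => t⁻¹ • (T t x - x)) (𝓝[>] 0) (𝓝 y)} := by
  intro x
  -- extend the orbit to a continuous function on the line
  set f : ℝ → X := fun s => T (max s 0) x with hf
  have hfc : Continuous f :=
    (hTcont x).comp_continuous (by fun_prop) fun s => le_max_right s 0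
  have hii : ∀ b c : ℝ, IntervalIntegrable f MeasureTheory.volume b c :=
    fun b c => hfc.intervalIntegrable b c
  have hder : ∀ c : ℝ, Tendsto (fun t : ℝ => t⁻¹ • ∫ s in c..(c + t), f s) (𝓝[>] 0)
      (𝓝 (f c)) := by
    intro c
    have h1 : HasDerivAt (fun u => ∫ s in c..u, f s) (f c) c :=
      intervalIntegral.integral_hasDerivAt_right (hii c c)
        (hfc.stronglyMeasurableAtFilter _ _) hfc.continuousAt
    simpa using (hasDerivAt_iff_tendsto_slope_zero.1 h1).mono_left
      (nhdsWithin_mono 0 (show Ioi (0 : ℝ) ⊆ {0}ᶜ from fun t ht => (mem_Ioi.1 ht).ne'))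
  have hdom : ∀ r : ℝ, 0 ≤ r → ∃ y, Tendsto
      (fun t : ℝ => t⁻¹ • (T t (∫ s in (0 : ℝ)..r, f s) - ∫ s in (0 : ℝ)..r, f s))
      (𝓝[>] 0) (𝓝 y) := by
    intro r hr
    refine ⟨f r - f 0, ((hder r).sub (hder 0)).congr' ?_⟩
    filter_upwards [self_mem_nhdsWithin] with t ht
    have ht' : (0 : ℝ) ≤ t := le_of_lt ht
    have e1 : T t (∫ s in (0 : ℝ)..r, f s) = ∫ s in t..(r + t), f s := by
      rw [← ContinuousLinearMap.intervalIntegral_comp_comm _ (hii 0 r)]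
      have : ∫ s in (0 : ℝ)..r, f (s + t) = ∫ s in t..(r + t), f s := by
        simp [intervalIntegral.integral_comp_add_right (fun s => f s) t]
      rw [← this]
      refine intervalIntegral.integral_congr fun s hs => ?_
      rw [uIcc_of_le hr] at hs
      simp only [hf]
      rw [max_eq_left hs.1, max_eq_left (by linarith [hs.1]), add_comm s t, hTsemi t s ht' hs.1]
      rfl
    have e2 := intervalIntegral.integral_interval_sub_interval_comm (hii t (r + t)) (hii 0 r)
      (hii t 0)
    rw [e1, e2, ← smul_sub, zero_add, intervalIntegral.integral_symm t 0]
    congr 1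
    rw [intervalIntegral.integral_symm (r + t) r]
    abel
  have hlim := hder 0
  have hf0 : f 0 = x := by simp [hf, hT0]
  rw [hf0] at hlim
  refine mem_closure_of_tendsto hlim ?_
  filter_upwards [self_mem_nhdsWithin] with r hr
  obtain ⟨y, hy⟩ := hdom r (le_of_lt hr)
  rw [zero_add]
  refine ⟨r⁻¹ • y, (hy.const_smul r⁻¹).congr fun t => ?_⟩
  rw [map_smul, ← smul_sub, smul_comm]

/-- Chernoff approximation for initial values in the domain of the generator. -/
lemma exists_norm_pow_apply_sub_orbit_le {a : ℝ} (ha : 0 ≤ a) {F : ℝ → X →L[ℝ] X}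
    (hF0 : F 0 = ContinuousLinearMap.id ℝ X)
    (hF : ∀ t : ℝ, 0 ≤ t → ‖F t‖ ≤ Real.exp (a * t)) {G : Set (X × X)}
    (hD : Dense (Prod.fst '' G))
    (hder : ∀ p ∈ G, Tendsto (fun t : ℝ => t⁻¹ • (F t p.1 - p.1)) (𝓝[>] 0) (𝓝 p.2))
    {T : ℝ → X →L[ℝ] X} (hT0 : T 0 = ContinuousLinearMap.id ℝ X)
    (hTsemi : ∀ s t : ℝ, 0 ≤ s → 0 ≤ t → T (s + t) = (T s).comp (T t))
    (hTcont : ∀ x : X, ContinuousOn (fun t : ℝ => T t x) (Ici 0))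
    {x w : X} (hx : Tendsto (fun t : ℝ => t⁻¹ • (T t x - x)) (𝓝[>] 0) (𝓝 w))
    {t₀ : ℝ} (ht₀ : 0 ≤ t₀) (hxG : ∀ s ∈ Icc 0 t₀, (T s x, T s w) ∈ closure G)
    {ε : ℝ} (hε : 0 < ε) :
    ∃ η > (0 : ℝ), ∀ h : ℝ, 0 ≤ h → h ≤ η → ∀ k : ℕ, k * h ≤ t₀ → ‖(F h ^ k) x - T (k * h) x‖ ≤ ε := by
  set ε₁ := ε / (2 * (Real.exp (a * t₀) * (2 * t₀ + 1)))
  have hε₁ : 0 < ε₁ := by positivity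
  have hK : IsCompact ((fun s => (T s x, T s w)) '' Icc 0 t₀) :=
    isCompact_Icc.image_of_continuousOn
      (((hTcont x).prodMk (hTcont w)).mono Icc_subset_Ici_self)
  obtain ⟨δ₁, hδ₁, H₁⟩ := exists_norm_pow_apply_sub_sub_smul_le ha hF0 hF hD hder hK
    (by rintro _ ⟨s, hs, rfl⟩; exact hxG s hs) hε₁
  obtain ⟨δ₂, hδ₂, H₂⟩ := exists_norm_orbit_sub_sub_smul_le hTsemi hTcont hx t₀ hε₁
  set δ := min 1 (min δ₁ δ₂)
  have hδ : 0 < δ := by positivity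
  have hδ1 : δ ≤ 1 := min_le_left _ _
  obtain ⟨η, hη, H₃⟩ := H₁ δ hδ ((min_le_right _ _).trans (min_le_left _ _))
  -- error propagation over a block of total length at most `δ`
  have hblock : ∀ h : ℝ, 0 ≤ h → h ≤ η → ∀ k m : ℕ, m * h ≤ δ → k * h ≤ t₀ →
      ‖(F h ^ (m + k)) x - T ((m + k : ℕ) * h) x‖
        ≤ Real.exp (a * (m * h)) * ‖(F h ^ k) x - T (k * h) x‖ + 2 * ε₁ * δ := by
    intro h hh hhη k m hm hk
    have hkh : (k : ℝ) * h ∈ Icc 0 t₀ := ⟨by positivity, hk⟩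
    have b1 := norm_pow_apply_le hF hh m ((F h ^ k) x - T (k * h) x)
    have b2 := H₃ _ (mem_image_of_mem _ hkh) h hh hhη m hm
    have hmh : 0 ≤ (m : ℝ) * h := by positivity
    have b3 := H₂ _ hkh (m * h) hmh
      (hm.trans ((min_le_right _ _).trans (min_le_right _ _)))
    have b3' : ‖T (k * h + m * h) x - T (k * h) x - (m * h) • T (k * h) w‖ ≤ ε₁ * δ :=
      b3.trans (by gcongr)
    have e1 : ((m + k : ℕ) : ℝ) * h = k * h + m * h := by push_cast; ring
    have e : (F h ^ (m + k)) x - T ((m + k : ℕ) * h) x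
        = (F h ^ m) ((F h ^ k) x - T (k * h) x)
          + ((F h ^ m) (T (k * h) x) - T (k * h) x - (m * h) • T (k * h) w)
          - (T (k * h + m * h) x - T (k * h) x - (m * h) • T (k * h) w) := by
      rw [e1, map_sub, pow_add, mul_apply_eq_comp]
      abel
    rw [e]
    refine (norm_sub_le _ _).trans ((add_le_add (norm_add_le _ _) b3').trans ?_)
    linarith
  refine ⟨min η (δ / 2), by positivity, fun h hh hhη k hk => ?_⟩
  have hhη' : h ≤ η := hhη.trans (min_le_left _ _)
  rcases hh.eq_or_lt with rfl | hpos
  · simp [hF0, hT0, hε.le, ← ContinuousLinearMap.one_def]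
  have hhδ : h ≤ δ / 2 := hhη.trans (min_le_right _ _)
  set m := ⌊δ / h⌋₊
  have hmδ : m * h ≤ δ := by
    have := Nat.floor_le (show 0 ≤ δ / h by positivity)
    exact (le_div_iff₀ hpos).1 this
  have hmδ' : δ / 2 ≤ m * h := by
    have := Nat.lt_floor_add_one (δ / h)
    rw [div_lt_iff₀ hpos] at this
    change δ < (m + 1) * h at this
    linarith
  have hind : ∀ j k : ℕ, k ≤ j * m → k * h ≤ t₀ →
      ‖(F h ^ k) x - T (k * h) x‖ ≤ Real.exp (a * (k * h)) * (j * (2 * ε₁ * δ)) := by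
    intro j
    induction j with
    | zero =>
      intro k hkj _
      obtain rfl : k = 0 := by simpa using hkj
      simp [hT0]
    | succ j ih =>
      intro k hkj hk
      rw [Nat.succ_mul] at hkj
      obtain ⟨m', k', hm', hk', rfl⟩ : ∃ m' k' : ℕ, m' ≤ m ∧ k' ≤ j * m ∧ k = m' + k' :=
        ⟨k - min k (j * m), min k (j * m), by omega, by omega, by omega⟩
      have hm'h : (m' : ℝ) * h ≤ δ := le_trans (by gcongr) hmδ
      have hk'h : (k' : ℝ) * h ≤ t₀ := by
        refine le_trans ?_ hk
        gcongr
        omega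
      calc _ ≤ _ := hblock h hh hhη' k' m' hm'h hk'h
        _ ≤ Real.exp (a * (m' * h)) * (Real.exp (a * (k' * h)) * (j * (2 * ε₁ * δ)))
            + Real.exp (a * ((m' + k' : ℕ) * h)) * (2 * ε₁ * δ) := by
          refine add_le_add ?_
            (le_mul_of_one_le_left (by positivity) (Real.one_le_exp (by positivity)))
          gcongr
          exact ih k' hk' hk'h
        _ = _ := by
          rw [← mul_assoc, ← Real.exp_add]
          push_cast
          ring_nf
  have hmpos : 0 < m := by
    rcases Nat.eq_zero_or_pos m with h0 | h0
    · rw [h0] at hmδ'; simp at hmδ'; linarith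
    · exact h0
  have hj : k ≤ (k / m + 1) * m := by
    rw [mul_comm]; exact (Nat.lt_mul_div_succ k hmpos).le
  have hjδ : ((k / m + 1 : ℕ) : ℝ) * δ ≤ 2 * t₀ + 1 := by
    have h1 : ((k / m : ℕ) : ℝ) * m ≤ k := by exact_mod_cast Nat.div_mul_le_self k m
    have h2 : ((k / m : ℕ) : ℝ) * (δ / 2) ≤ (k / m : ℕ) * (m * h) := by gcongr
    have h3 : ((k / m : ℕ) : ℝ) * m * h ≤ k * h := by gcongr
    push_cast
    nlinarith
  calc _ ≤ _ := hind (k / m + 1) k hj hk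
    _ = Real.exp (a * (k * h)) * (((k / m + 1 : ℕ) : ℝ) * δ * (2 * ε₁)) := by ring
    _ ≤ Real.exp (a * t₀) * ((2 * t₀ + 1) * (2 * ε₁)) := by gcongr
    _ = ε := by simp only [ε₁]; field_simp

end Chernoff

/-- **Chernoff's theorem.** Let `X` be a real Banach space, `a ∈ [0,∞)`, and
`F : [0,∞) → L(X)` with `F 0 = id`, `‖F t‖ ≤ exp (a t)`, `t ↦ F t x` strongly continuous.
Let `L0` be the restriction of the strong derivative `F'(0)` to a linear subspace `D` of its
domain (encoded as: `L0` is a partially defined linear operator such that for every `x` in its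
domain, `(F t x - x)/t → L0 x` as `t → 0+`), assume `L0` is closable with closure `L0.closure`,
and let `(T t)` be a strongly continuous semigroup of bounded operators whose generator is
exactly `L0.closure`. Then for every `t₀ > 0` and `x ∈ X`, `(F (t/n))^n x → T t x`
uniformly in `t ∈ [0, t₀]`. -/
theorem chernoff_theorem
    {X : Type*} [NormedAddCommGroup X] [NormedSpace ℝ X] [CompleteSpace X]
    (a : ℝ) (ha : 0 ≤ a)
    (F : ℝ → X →L[ℝ] X)
    (hF0 : F 0 = ContinuousLinearMap.id ℝ X)
    (hFnorm : ∀ t : ℝ, 0 ≤ t → ‖F t‖ ≤ Real.exp (a * t))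
    (hFcont : ∀ x : X, ContinuousOn (fun t : ℝ => F t x) (Ici 0))
    (L0 : X →ₗ.[ℝ] X)
    (hL0 : ∀ x : L0.domain,
      Tendsto (fun t : ℝ => t⁻¹ • (F t (x : X) - (x : X))) (𝓝[>] 0) (𝓝 (L0 x)))
    (hclosable : L0.IsClosable)
    (T : ℝ → X →L[ℝ] X)
    (hT0 : T 0 = ContinuousLinearMap.id ℝ X)
    (hTsemi : ∀ s t : ℝ, 0 ≤ s → 0 ≤ t → T (s + t) = (T s).comp (T t))
    (hTcont : ∀ x : X, ContinuousOn (fun t : ℝ => T t x) (Ici 0))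
    (hgen_dom : ∀ x : X, x ∈ L0.closure.domain ↔
      ∃ y : X, Tendsto (fun t : ℝ => t⁻¹ • (T t x - x)) (𝓝[>] 0) (𝓝 y))
    (hgen : ∀ x : L0.closure.domain,
      Tendsto (fun t : ℝ => t⁻¹ • (T t (x : X) - (x : X))) (𝓝[>] 0) (𝓝 (L0.closure x)))
    (t₀ : ℝ) (ht₀ : 0 < t₀) (x : X) :
    TendstoUniformlyOn (fun (n : ℕ) (t : ℝ) => ((F (t / n)) ^ n) x)
      (fun t : ℝ => T t x) atTop (Icc 0 t₀) := by
  have hxclosure : ∀ (y z : X), Tendsto (fun t : ℝ => t⁻¹ • (T t y - y)) (𝓝[>] 0) (𝓝 z) →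
      (y, z) ∈ closure (L0.graph : Set (X × X)) := by
    intro y z hyz
    have hy : y ∈ L0.closure.domain := (hgen_dom y).2 ⟨z, hyz⟩
    have hz : z = L0.closure ⟨y, hy⟩ := tendsto_nhds_unique hyz (hgen ⟨y, hy⟩)
    have hmem : (y, z) ∈ L0.closure.graph := hz ▸ L0.closure.mem_graph ⟨y, hy⟩
    rw [← hclosable.graph_closure_eq_closure_graph] at hmem
    exact hmem
  have hdomT := Chernoff.dense_generator_domain hT0 hTsemi hTcont
  have hdense : Dense (Prod.fst '' (L0.graph : Set (X × X))) := by
    refine Dense.of_closure (hdomT.mono ?_)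
    rintro y ⟨z, hyz⟩
    exact image_closure_subset_closure_image continuous_fst ⟨_, hxclosure y z hyz, rfl⟩
  have hder : ∀ p ∈ (L0.graph : Set (X × X)),
      Tendsto (fun t : ℝ => t⁻¹ • (F t p.1 - p.1)) (𝓝[>] 0) (𝓝 p.2) := by
    intro p hp
    obtain ⟨y, hy1, hy2⟩ := (LinearPMap.mem_graph_iff L0).1 hp
    rw [← hy1, ← hy2]
    exact hL0 y
  obtain ⟨M, hM⟩ : ∃ M, ∀ s : Icc 0 t₀, ‖T s‖ ≤ M := by
    refine banach_steinhaus fun y => ?_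
    obtain ⟨C, hC⟩ := isCompact_Icc.exists_bound_of_continuousOn
      ((hTcont y).mono (Icc_subset_Ici_self : Icc 0 t₀ ⊆ Ici 0))
    exact ⟨C, fun s => hC s s.2⟩
  have hM0 : 0 ≤ M := (norm_nonneg _).trans (hM ⟨0, le_rfl, ht₀.le⟩)
  rw [Metric.tendstoUniformlyOn_iff]
  intro ε hε
  set C := Real.exp (a * t₀) + M
  have hC : 0 < C := by positivity
  obtain ⟨y, hyx, z, hyz⟩ := Metric.dense_iff.1 hdomT x (ε / (2 * C)) (by positivity)
  obtain ⟨η, hη, H⟩ := Chernoff.exists_norm_pow_apply_sub_orbit_le ha hF0 hFnorm hdense hder hT0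
    hTsemi hTcont hyz ht₀.le
    (fun s hs => hxclosure _ _ (Chernoff.tendsto_generator_orbit hTsemi hyz hs.1))
    (show 0 < ε / 4 by positivity)
  have hlim : ∀ᶠ n : ℕ in atTop, t₀ / n ≤ η :=
    (tendsto_const_div_atTop_nhds_zero_nat t₀).eventually (ge_mem_nhds hη)
  filter_upwards [hlim, eventually_gt_atTop 0] with n hn hn0 t ht
  have hn0' : (0 : ℝ) < n := by exact_mod_cast hn0
  have hnt : n * (t / n) = t := by field_simp
  have htn : 0 ≤ t / n := div_nonneg ht.1 hn0'.le
  have b1 : ‖(F (t / n) ^ n) y - T t y‖ ≤ ε / 4 := by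
    have := H (t / n) htn (le_trans (by gcongr; exact ht.2) hn) n (hnt.le.trans ht.2)
    rwa [hnt] at this
  have b2 := Chernoff.norm_pow_apply_le_of_le ha hFnorm htn (hnt.le.trans ht.2) (x - y)
  have b3 : ‖T t (x - y)‖ ≤ M * ‖x - y‖ := (T t).le_of_opNorm_le (hM ⟨t, ht⟩) _
  have hxy : ‖x - y‖ ≤ ε / (2 * C) := by
    rw [← dist_eq_norm, dist_comm]
    exact le_of_lt hyx
  have b4 : C * ‖x - y‖ ≤ ε / 2 := by
    calc C * ‖x - y‖ ≤ C * (ε / (2 * C)) := by gcongr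
      _ = ε / 2 := by field_simp
  rw [dist_comm, dist_eq_norm]
  have e : (F (t / n) ^ n) x - T t x
      = (F (t / n) ^ n) (x - y) + ((F (t / n) ^ n) y - T t y) - T t (x - y) := by
    simp only [map_sub]
    abel
  rw [e]
  calc _ ≤ Real.exp (a * t₀) * ‖x - y‖ + ε / 4 + M * ‖x - y‖ :=
        (norm_sub_le _ _).trans (add_le_add ((norm_add_le _ _).trans (add_le_add b2 b1)) b3)
    _ = C * ‖x - y‖ + ε / 4 := by simp only [C]; ring
    _ < ε := by linarith
end

section
/- Fix d ≥ 1, τ ∈ (0,1], t > 0. Let A : ℝ^d → ℝ^{d×d} be continuous with values in real symmetric matrices, b : ℝ^d → ℝ^d and c : ℝ^d → ℝ continuous and bounded, and assume there are 0 < a₀ ≤ A₀ with a₀|p|² ≤ p·A(q)p ≤ A₀|p|² for all q, p. For x, z ∈ ℝ^d set g_t^x(z) = (4πt)^{-d/2} (det A(x))^{-1/2} e^{-t c(x)} exp( −(z − t b(x))·A(x)^{-1}(z − t b(x)) / (4t) ). Suppose k ≥ 0 is such that for every θ ∈ (0,1], every s > 0 and every ψ ∈ L¹(ℝ^d), the function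 G^θ(s)ψ(q) := ∫_{ℝ^d} g_s^{θ q}(q − q₁) ψ(q₁) dq₁ satisfies ‖G^θ(s)ψ‖_{L¹} ≤ e^{k s} ‖ψ‖_{L¹}. Then for every φ ∈ L¹(ℝ^d), the function F_τ(t)φ(q) := ∫_{ℝ^d} g_t^{τq + (1−τ)q₁}(q − q₁) φ(q₁) dq₁ is in L¹(ℝ^d) and ‖F_τ(t)φ‖_{L¹} ≤ e^{k t} ‖φ‖_{L¹}. -/
open MeasureTheory Filter Topology Set RealInnerProductSpace

noncomputable section

/-- `ℝ^d` as a Euclidean space. -/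
abbrev Ed (d : ℕ) := EuclideanSpace ℝ (Fin d)

/-- The quadratic form `p ↦ p · M p` of a matrix `M`. -/
def quadF {d : ℕ} (M : Matrix (Fin d) (Fin d) ℝ) (v : Ed d) : ℝ :=
  ∑ i, ∑ j, v i * M i j * v j

/-- The Gaussian-type kernel
`g_t^x(z) = (4πt)^{-d/2} (det A(x))^{-1/2} e^{-t c(x)} exp(−(z−t b(x))·A(x)⁻¹(z−t b(x))/(4t))`. -/
def gker {d : ℕ} (A : Ed d → Matrix (Fin d) (Fin d) ℝ) (b : Ed d → Ed d) (c : Ed d → ℝ)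
    (t : ℝ) (x z : Ed d) : ℝ :=
  (4 * Real.pi * t) ^ (-(d : ℝ) / 2) * (A x).det ^ (-(1 : ℝ) / 2) * Real.exp (-(t * c x)) *
    Real.exp (-(quadF (A x)⁻¹ (z - t • b x)) / (4 * t))

/-- Schur-type transfer for a nonnegative kernel `g x z`: an `L¹` bound for the operator with kernel
`g (τ q) (q - q₁)` gives the same bound for the one with kernel
`g (τ q + (1 - τ) q₁) (q - q₁)`. -/
theorem integrable_and_integral_norm_le_of_frozen_kernel {E : Type*} [NormedAddCommGroup E]
    [NormedSpace ℝ E] [FiniteDimensional ℝ E] [MeasurableSpace E] [BorelSpace E]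
    (μ : Measure E) [μ.IsAddHaarMeasure] {g : E → E → ℝ}
    (hgm : Measurable (Function.uncurry g)) (hg0 : ∀ x z, 0 ≤ g x z)
    (hgb : ∀ x, ∃ C, ∀ z, g x z ≤ C) {τ M : ℝ} (hτ : 0 < τ)
    (hG : ∀ ψ : E → ℂ, Integrable ψ μ →
      Integrable (fun q => ∫ q₁, (g (τ • q) (q - q₁) : ℂ) * ψ q₁ ∂μ) μ ∧
      ∫ q, ‖∫ q₁, (g (τ • q) (q - q₁) : ℂ) * ψ q₁ ∂μ‖ ∂μ ≤ M * ∫ q, ‖ψ q‖ ∂μ)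
    {φ : E → ℂ} (hφ : Integrable φ μ) :
    Integrable (fun q => ∫ q₁, (g (τ • q + (1 - τ) • q₁) (q - q₁) : ℂ) * φ q₁ ∂μ) μ ∧
    ∫ q, ‖∫ q₁, (g (τ • q + (1 - τ) • q₁) (q - q₁) : ℂ) * φ q₁ ∂μ‖ ∂μ
      ≤ M * ∫ q, ‖φ q‖ ∂μ := by
  have hτ0 : τ ≠ 0 := hτ.ne'
  set n := Module.finrank ℝ E
  have hψ : Integrable (fun x => ‖φ (τ • x)‖) μ := (hφ.comp_smul hτ0).norm
  have hψc : Integrable (fun x => ((‖φ (τ • x)‖ : ℝ) : ℂ)) μ := hψ.ofReal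
  obtain ⟨hGi, hGle⟩ := hG _ hψc
  set H : E × E → ℝ := fun p => g (τ • p.1) (p.1 - p.2) * ‖φ (τ • p.2)‖ with hH
  have hH0 : ∀ p, 0 ≤ H p := fun p => mul_nonneg (hg0 _ _) (norm_nonneg _)
  have hnorm : ∀ y, ‖∫ x, (g (τ • y) (y - x) : ℂ) * ((‖φ (τ • x)‖ : ℝ) : ℂ) ∂μ‖
      = ∫ x, H (y, x) ∂μ := by
    intro y
    simp only [← Complex.ofReal_mul]
    rw [integral_complex_ofReal, Complex.norm_real, Real.norm_of_nonneg]
    exact integral_nonneg fun x => hH0 (y, x)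
  have hHm : AEStronglyMeasurable H (μ.prod μ) := by
    refine AEStronglyMeasurable.mul ?_ hψ.aestronglyMeasurable.comp_snd
    exact (hgm.comp (f := fun p : E × E => (τ • p.1, p.1 - p.2))
      (by fun_prop)).aestronglyMeasurable
  have hHnorm : ∀ y, ∫ x, ‖H (y, x)‖ ∂μ = ∫ x, H (y, x) ∂μ := fun y => by
    simp only [Real.norm_of_nonneg (hH0 _)]
  have hHi : Integrable H (μ.prod μ) := by
    refine (integrable_prod_iff hHm).2 ⟨Eventually.of_forall fun y => ?_, ?_⟩
    · obtain ⟨C, hC⟩ := hgb (τ • y)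
      refine hψ.bdd_mul (c := C) (hgm.comp (f := fun x : E => (τ • y, y - x))
        (by fun_prop)).aestronglyMeasurable (Eventually.of_forall fun x => ?_)
      change ‖g (τ • y) (y - x)‖ ≤ C
      rw [Real.norm_of_nonneg (hg0 _ _)]
      exact hC _
    · simpa only [hHnorm, hnorm] using hGi.norm
  set K : E × E → ℂ := fun p => (g (τ • p.1 + (1 - τ) • p.2) (p.1 - p.2) : ℂ) * φ p.2 with hK
  have hKH : ∀ q q₁, ‖K (q, q₁)‖ = H (q + ((1 - τ) / τ) • q₁, τ⁻¹ • q₁) := by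
    intro q q₁
    have h1 : τ • (q + ((1 - τ) / τ) • q₁) = τ • q + (1 - τ) • q₁ := by
      rw [smul_add, smul_smul, mul_div_cancel₀ _ hτ0]
    have h2 : q + ((1 - τ) / τ) • q₁ - τ⁻¹ • q₁ = q - q₁ := by
      rw [show (1 - τ) / τ = τ⁻¹ - 1 by field_simp, sub_smul, one_smul]
      abel
    simp only [hK, hH, h1, h2, smul_inv_smul₀ hτ0, norm_mul, Complex.norm_real,
      Real.norm_of_nonneg (hg0 _ _)]
  have hKm : AEStronglyMeasurable K (μ.prod μ) := by
    refine AEStronglyMeasurable.mul ?_ hφ.aestronglyMeasurable.comp_snd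
    exact (Complex.measurable_ofReal.comp (hgm.comp
      (f := fun p : E × E => (τ • p.1 + (1 - τ) • p.2, p.1 - p.2))
      (by fun_prop))).aestronglyMeasurable
  have hKint : ∀ q₁, ∫ q, ‖K (q, q₁)‖ ∂μ = ∫ y, H (y, τ⁻¹ • q₁) ∂μ := fun q₁ => by
    simp only [hKH]
    exact integral_add_right_eq_self (fun y => H (y, τ⁻¹ • q₁)) _
  have hJ : Integrable (fun x => ∫ y, H (y, x) ∂μ) μ := hHi.integral_prod_right
  have hKi : Integrable K (μ.prod μ) := by
    refine (integrable_prod_iff' hKm).2 ⟨?_, ?_⟩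
    · have hae : ∀ᵐ x ∂μ, Integrable (fun y => H (y, x)) μ := hHi.prod_left_ae
      have hq : Measure.QuasiMeasurePreserving (fun x : E => τ⁻¹ • x) μ μ := by
        refine ⟨measurable_const_smul _, ?_⟩
        rw [Measure.map_addHaar_smul μ (inv_ne_zero hτ0)]
        exact Measure.smul_absolutelyContinuous
      filter_upwards [hq.ae hae, hKm.prodMk_right] with q₁ h1 h2
      refine (integrable_norm_iff h2).1 ?_
      simp only [hKH]
      exact h1.comp_add_right _
    · simp only [hKint]
      exact hJ.comp_smul (inv_ne_zero hτ0)
  refine ⟨hKi.integral_prod_left, ?_⟩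
  calc ∫ q, ‖∫ q₁, K (q, q₁) ∂μ‖ ∂μ
      ≤ ∫ q, ∫ q₁, ‖K (q, q₁)‖ ∂μ ∂μ :=
        integral_mono hKi.integral_prod_left.norm hKi.norm.integral_prod_left
          fun q => norm_integral_le_integral_norm _
    _ = ∫ q₁, ∫ q, ‖K (q, q₁)‖ ∂μ ∂μ := integral_integral_swap hKi.norm
    _ = τ ^ n * ∫ x, ∫ y, H (y, x) ∂μ ∂μ := by
        simp only [hKint]
        rw [Measure.integral_comp_inv_smul μ (fun x => ∫ y, H (y, x) ∂μ),
          abs_of_pos (pow_pos hτ n), smul_eq_mul]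
    _ = τ ^ n * ∫ y, ∫ x, H (y, x) ∂μ ∂μ := by
        rw [integral_integral_swap (f := fun y x => H (y, x)) hHi]
    _ ≤ τ ^ n * (M * ∫ x, ‖φ (τ • x)‖ ∂μ) := by
        refine mul_le_mul_of_nonneg_left ?_ (pow_nonneg hτ.le n)
        simpa only [hnorm, Complex.norm_real, norm_norm] using hGle
    _ = M * ∫ q, ‖φ q‖ ∂μ := by
        rw [Measure.integral_comp_smul μ (fun x => ‖φ x‖), smul_eq_mul,
          abs_of_pos (inv_pos.2 (pow_pos hτ n))]
        field_simp

theorem quadF_eq_dotProduct {d : ℕ} (M : Matrix (Fin d) (Fin d) ℝ) (v : Ed d) :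
    quadF M v = v.ofLp ⬝ᵥ M.mulVec v.ofLp := by
  simp only [quadF, dotProduct, Matrix.mulVec, Finset.mul_sum, mul_assoc]

theorem posDef_of_quadF_pos {d : ℕ} {M : Matrix (Fin d) (Fin d) ℝ} (hM : M.IsSymm)
    (h : ∀ v : Ed d, v ≠ 0 → 0 < quadF M v) : M.PosDef := by
  refine Matrix.PosDef.of_dotProduct_mulVec_pos (by simpa using hM) fun x hx => ?_
  have := h (WithLp.toLp 2 x) (by simpa using hx)
  rwa [quadF_eq_dotProduct] at this

theorem quadF_nonneg {d : ℕ} {M : Matrix (Fin d) (Fin d) ℝ} (hM : M.PosSemidef) (v : Ed d) :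
    0 ≤ quadF M v := by
  rw [quadF_eq_dotProduct]
  exact hM.dotProduct_mulVec_nonneg v.ofLp

section Kernel

variable {d : ℕ} {A : Ed d → Matrix (Fin d) (Fin d) ℝ} {b : Ed d → Ed d} {c : Ed d → ℝ} {t : ℝ}

theorem gker_prefactor_nonneg (ht : 0 < t) {x : Ed d} (hA : (A x).PosDef) :
    0 ≤ (4 * Real.pi * t) ^ (-(d : ℝ) / 2) * (A x).det ^ (-(1 : ℝ) / 2) *
      Real.exp (-(t * c x)) := by
  have := hA.det_pos
  positivity

theorem gker_nonneg (ht : 0 < t) {x : Ed d} (hA : (A x).PosDef) (z : Ed d) :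
    0 ≤ gker A b c t x z :=
  mul_nonneg (gker_prefactor_nonneg ht hA) (Real.exp_nonneg _)

theorem gker_le (ht : 0 < t) {x : Ed d} (hA : (A x).PosDef) (z : Ed d) :
    gker A b c t x z ≤ (4 * Real.pi * t) ^ (-(d : ℝ) / 2) * (A x).det ^ (-(1 : ℝ) / 2) *
      Real.exp (-(t * c x)) := by
  refine mul_le_of_le_one_right (gker_prefactor_nonneg ht hA) (Real.exp_le_one_iff.2 ?_)
  exact div_nonpos_of_nonpos_of_nonneg
    (neg_nonpos.2 (quadF_nonneg hA.inv.posSemidef _)) (by positivity)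

theorem measurable_uncurry_gker (hA : Continuous A) (hb : Continuous b) (hc : Continuous c)
    (hdet : ∀ x, (A x).det ≠ 0) : Measurable (Function.uncurry (gker A b c t)) := by
  have hinv : Continuous fun x => (A x)⁻¹ := by
    simp only [Matrix.inv_def, Ring.inverse_eq_inv']
    exact (hA.matrix_det.inv₀ hdet).smul hA.matrix_adjugate
  have hrpow : Continuous fun x => (A x).det ^ (-(1 : ℝ) / 2) :=
    hA.matrix_det.rpow_const fun x => Or.inl (hdet x)
  have hentry : ∀ i j, Continuous fun p : Ed d × Ed d => (A p.1)⁻¹ i j := fun i j =>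
    (hinv.matrix_elem i j).comp continuous_fst
  have hshift : Continuous fun p : Ed d × Ed d => p.2 - t • b p.1 := by fun_prop
  have hcoord : ∀ i, Continuous fun p : Ed d × Ed d => (p.2 - t • b p.1) i := fun i =>
    (EuclideanSpace.proj (𝕜 := ℝ) i).continuous.comp hshift
  have hquad : Continuous fun p : Ed d × Ed d => quadF (A p.1)⁻¹ (p.2 - t • b p.1) :=
    continuous_finsetSum _ fun i _ => continuous_finsetSum _ fun j _ =>
      ((hcoord i).mul (hentry i j)).mul (hcoord j)
  have hpre : Continuous fun x => (4 * Real.pi * t) ^ (-(d : ℝ) / 2) *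
      (A x).det ^ (-(1 : ℝ) / 2) * Real.exp (-(t * c x)) :=
    (continuous_const.mul hrpow).mul (Real.continuous_exp.comp (continuous_const.mul hc).neg)
  exact ((hpre.comp continuous_fst).mul
    (Real.continuous_exp.comp (hquad.neg.div_const (4 * t)))).measurable

end Kernel

/-- If for every `θ ∈ (0,1]` the operators `G^θ(s)ψ(q) = ∫ g_s^{θq}(q−q₁)ψ(q₁)dq₁` are bounded
on `L¹` by `e^{ks}`, then for `τ ∈ (0,1]` the operator
`F_τ(t)φ(q) = ∫ g_t^{τq+(1−τ)q₁}(q−q₁)φ(q₁)dq₁` is bounded on `L¹` by `e^{kt}`. -/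
theorem statement7 {d : ℕ} (hd : 1 ≤ d) (τ : ℝ) (hτ : τ ∈ Set.Ioc (0 : ℝ) 1)
    (t : ℝ) (ht : 0 < t)
    (A : Ed d → Matrix (Fin d) (Fin d) ℝ) (hAcont : Continuous A)
    (hAsymm : ∀ q, (A q).IsSymm)
    (b : Ed d → Ed d) (hbcont : Continuous b) (hbb : ∃ C : ℝ, ∀ q, ‖b q‖ ≤ C)
    (c : Ed d → ℝ) (hccont : Continuous c) (hcb : ∃ C : ℝ, ∀ q, |c q| ≤ C)
    (a₀ A₀ : ℝ) (ha₀ : 0 < a₀) (ha₀A₀ : a₀ ≤ A₀)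
    (hell : ∀ q p : Ed d, a₀ * ‖p‖ ^ 2 ≤ quadF (A q) p ∧ quadF (A q) p ≤ A₀ * ‖p‖ ^ 2)
    (k : ℝ) (hk : 0 ≤ k)
    (hG : ∀ θ ∈ Set.Ioc (0 : ℝ) 1, ∀ s : ℝ, 0 < s → ∀ ψ : Ed d → ℂ, Integrable ψ →
      Integrable (fun q : Ed d => ∫ q₁ : Ed d, ((gker A b c s (θ • q) (q - q₁) : ℝ) : ℂ) * ψ q₁) ∧
      ∫ q : Ed d, ‖∫ q₁ : Ed d, ((gker A b c s (θ • q) (q - q₁) : ℝ) : ℂ) * ψ q₁‖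
        ≤ Real.exp (k * s) * ∫ q : Ed d, ‖ψ q‖)
    (φ : Ed d → ℂ) (hφ : Integrable φ) :
    Integrable (fun q : Ed d =>
      ∫ q₁ : Ed d, ((gker A b c t (τ • q + (1 - τ) • q₁) (q - q₁) : ℝ) : ℂ) * φ q₁) ∧
    ∫ q : Ed d, ‖∫ q₁ : Ed d, ((gker A b c t (τ • q + (1 - τ) • q₁) (q - q₁) : ℝ) : ℂ) * φ q₁‖
      ≤ Real.exp (k * t) * ∫ q : Ed d, ‖φ q‖ := by
  have hpos : ∀ q, (A q).PosDef := fun q => posDef_of_quadF_pos (hAsymm q) fun v hv =>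
    lt_of_lt_of_le (mul_pos ha₀ (pow_pos (norm_pos_iff.2 hv) 2)) (hell q v).1
  exact integrable_and_integral_norm_le_of_frozen_kernel volume
    (measurable_uncurry_gker hAcont hbcont hccont fun x => (hpos x).det_pos.ne')
    (fun x z => gker_nonneg ht (hpos x) z) (fun x => ⟨_, gker_le ht (hpos x)⟩)
    hτ.1 (hG τ hτ t ht) hφ
end
end

section
/- Fix d ≥ 1 and τ ∈ [0,1]. Let A : ℝ^d → ℝ^{d×d} take values in real symmetric matrices, b : ℝ^d → ℝ^d, c : ℝ^d → ℝ, all continuous and bounded together with all their partial derivatives up to order 4, and assume a₀|p|² ≤ p·A(q)p ≤ A₀|p|² for all q, p and some 0 < a₀ ≤ A₀. For t > 0 define F_τ(t)φ(q) = ∫_{ℝ^d} g_t^{τq + (1−τ)q₁}(q − q₁) φ(q₁) dq₁ with g_t^x(z) = (4πt)^{-d/2} (det A(x))^{-1/2} e^{-t c(x)} exp( −(z − t b(x))·A(x)^{-1}(z − t b(x)) / (4t) ), and set F_τ(0)φ = φ. Then for every φ ∈ C_c^∞(ℝ^d) and every t₀ ≥ 0, lim_{t→t₀, t≥0} ‖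 F_τ(t)φ − F_τ(t₀)φ ‖_{L¹(ℝ^d)} = 0. -/
open MeasureTheory Filter Topology Set RealInnerProductSpace

noncomputable section

/-- The integral operator `F_τ(t)φ(q) = ∫ g_t^{τq+(1−τ)q₁}(q − q₁)φ(q₁) dq₁` (with
`F_τ(0)φ = φ`). -/
def Fop {d : ℕ} (A : Ed d → Matrix (Fin d) (Fin d) ℝ) (b : Ed d → Ed d) (c : Ed d → ℝ)
    (τ : ℝ) (φ : Ed d → ℂ) (t : ℝ) (q : Ed d) : ℂ :=
  if t = 0 then φ q
  else ∫ q₁ : Ed d, ((gker A b c t (τ • q + (1 - τ) • q₁) (q - q₁) : ℝ) : ℂ) * φ q₁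

theorem quadF_smul {d : ℕ} (M : Matrix (Fin d) (Fin d) ℝ) (r : ℝ) (v : Ed d) :
    quadF M (r • v) = r ^ 2 * quadF M v := by
  simp only [quadF, Finset.mul_sum, PiLp.smul_apply, smul_eq_mul]
  exact Finset.sum_congr rfl fun i _ => Finset.sum_congr rfl fun j _ => by ring

theorem dotProduct_self_eq_norm_sq {d : ℕ} (v : Ed d) : v.ofLp ⬝ᵥ v.ofLp = ‖v‖ ^ 2 := by
  rw [EuclideanSpace.real_norm_sq_eq]
  simp [dotProduct, sq]

theorem posDef_of_quadF {d : ℕ} {M : Matrix (Fin d) (Fin d) ℝ} (hM : M.IsSymm) {a : ℝ}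
    (ha : 0 < a) (h : ∀ p : Ed d, a * ‖p‖ ^ 2 ≤ quadF M p) : M.PosDef := by
  refine Matrix.PosDef.of_dotProduct_mulVec_pos ?_ fun x hx => ?_
  · rwa [Matrix.IsHermitian, Matrix.conjTranspose_eq_transpose_of_trivial]
  · have h1 := h (WithLp.toLp 2 x)
    rw [quadF_eq_dotProduct] at h1
    have h2 : 0 < ‖WithLp.toLp 2 x‖ := norm_pos_iff.2 (by simpa using hx)
    refine lt_of_lt_of_le (by positivity) (h1.trans_eq (by simp))

/-- A lower ellipticity bound on a symmetric matrix bounds its determinant from below. -/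
theorem pow_le_det_of_quadF {d : ℕ} {M : Matrix (Fin d) (Fin d) ℝ} (hM : M.IsSymm) {a : ℝ}
    (ha : 0 < a) (h : ∀ p : Ed d, a * ‖p‖ ^ 2 ≤ quadF M p) : a ^ d ≤ M.det := by
  have hH := (posDef_of_quadF hM ha h).isHermitian
  rw [hH.det_eq_prod_eigenvalues]
  have h1 : ∀ i, a ≤ hH.eigenvalues i := fun i => by
    have := h (hH.eigenvectorBasis i)
    rw [hH.eigenvalues_eq i]
    rw [quadF_eq_dotProduct, (hH.eigenvectorBasis.orthonormal.1 i)] at this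
    simpa using this
  calc a ^ d = ∏ _i : Fin d, a := by simp
    _ ≤ _ := Finset.prod_le_prod (fun _ _ => ha.le) fun i _ => by simpa using h1 i

/-- An upper ellipticity bound on a positive definite matrix bounds its inverse from below. -/
theorem norm_sq_div_le_quadF_inv {d : ℕ} {M : Matrix (Fin d) (Fin d) ℝ} (hM : M.PosDef) {K : ℝ}
    (hK : 0 < K) (h : ∀ p : Ed d, quadF M p ≤ K * ‖p‖ ^ 2) (v : Ed d) :
    ‖v‖ ^ 2 / K ≤ quadF M⁻¹ v := by
  have hu : IsUnit M.det := (Matrix.isUnit_iff_isUnit_det M).1 hM.isUnit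
  have hs : M.transpose = M := by
    simpa [Matrix.IsHermitian, Matrix.conjTranspose_eq_transpose_of_trivial] using hM.isHermitian
  set w := M⁻¹.mulVec v.ofLp with hw
  have hMw : M.mulVec w = v.ofLp := by simp [hw, Matrix.mulVec_mulVec, Matrix.mul_nonsing_inv _ hu]
  have h0 := hM.posSemidef.dotProduct_mulVec_nonneg (w - K⁻¹ • v.ofLp)
  have h1 := h v
  rw [quadF_eq_dotProduct] at h1 ⊢
  have h2 : w ⬝ᵥ M.mulVec v.ofLp = ‖v‖ ^ 2 := by
    rw [Matrix.dotProduct_mulVec, ← Matrix.mulVec_transpose, hs, hMw, dotProduct_self_eq_norm_sq]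
  rw [star_trivial, Matrix.mulVec_sub, Matrix.mulVec_smul, hMw, sub_dotProduct, dotProduct_sub,
    dotProduct_sub, dotProduct_smul, smul_dotProduct, smul_dotProduct, dotProduct_smul, h2,
    dotProduct_self_eq_norm_sq, dotProduct_comm w] at h0
  simp only [smul_eq_mul] at h0
  have h3 : K⁻¹ * (K⁻¹ * (v.ofLp ⬝ᵥ M.mulVec v.ofLp)) ≤ K⁻¹ * (K⁻¹ * (K * ‖v‖ ^ 2)) := by gcongr
  have h4 : K⁻¹ * (K⁻¹ * (K * ‖v‖ ^ 2)) = ‖v‖ ^ 2 / K := by field_simp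
  have h5 : K⁻¹ * ‖v‖ ^ 2 = ‖v‖ ^ 2 / K := by field_simp
  linarith

theorem integral_comp_toEuclideanLin {d : ℕ} {C : Matrix (Fin d) (Fin d) ℝ} (hC : C.det ≠ 0)
    {f : Ed d → ℝ} (hf : Continuous f) :
    ∫ z, f (Matrix.toEuclideanLin C z) = |C.det|⁻¹ * ∫ z, f z := by
  have hdet : LinearMap.det (Matrix.toEuclideanLin C) = C.det := LinearMap.det_toLpLin _ _
  have h := Measure.map_linearMap_addHaar_eq_smul_addHaar (volume : Measure (Ed d))
    (f := Matrix.toEuclideanLin C) (by rwa [hdet])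
  have hm : Measurable (Matrix.toEuclideanLin C) :=
    (LinearMap.continuous_of_finiteDimensional _).measurable
  rw [← integral_map hm.aemeasurable hf.aestronglyMeasurable, h, integral_smul_measure, hdet,
    ENNReal.toReal_ofReal (abs_nonneg _), abs_inv, smul_eq_mul]

open scoped MatrixOrder Matrix.Norms.L2Operator in
theorem integral_exp_neg_quadF_inv {d : ℕ} {M : Matrix (Fin d) (Fin d) ℝ} (hM : M.PosDef) :
    ∫ z, Real.exp (-(quadF M⁻¹ z) / 4) = (4 * Real.pi) ^ ((d : ℝ) / 2) * M.det ^ ((1 : ℝ) / 2) := by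
  obtain ⟨C, hC⟩ := CStarAlgebra.nonneg_iff_eq_star_mul_self.1 hM.inv.posSemidef.nonneg
  rw [Matrix.star_eq_conjTranspose, Matrix.conjTranspose_eq_transpose_of_trivial] at hC
  have hq : ∀ z, quadF M⁻¹ z = ‖Matrix.toEuclideanLin C z‖ ^ 2 := fun z => by
    rw [quadF_eq_dotProduct, hC, ← dotProduct_self_eq_norm_sq, ← Matrix.mulVec_mulVec,
      Matrix.dotProduct_mulVec, Matrix.vecMul_transpose]
    rfl
  have hdet : M.det⁻¹ = C.det ^ 2 := by
    rw [← Ring.inverse_eq_inv', ← Matrix.det_nonsing_inv, hC]; simp [sq]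
  have hpos := hM.det_pos
  have hC0 : C.det ≠ 0 := fun h0 => by rw [h0] at hdet; simp at hdet; exact hpos.ne' hdet
  have h1 : |C.det|⁻¹ = M.det ^ ((1 : ℝ) / 2) := by
    rw [← Real.sqrt_eq_rpow, ← Real.sqrt_sq_eq_abs, ← hdet, Real.sqrt_inv, inv_inv]
  have h2 := GaussianFourier.integral_rexp_neg_mul_sq_norm (V := Ed d) (b := 1 / 4) (by norm_num)
  have h3 := integral_comp_toEuclideanLin hC0 (f := fun z => Real.exp (-(1 / 4) * ‖z‖ ^ 2))
    (by fun_prop)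
  rw [h2, h1] at h3
  have h4 : (fun z => Real.exp (-(quadF M⁻¹ z) / 4))
      = fun z => Real.exp (-(1 / 4) * ‖Matrix.toEuclideanLin C z‖ ^ 2) := by
    funext z; rw [hq]; ring_nf
  rw [h4, h3, mul_comm]
  simp [mul_comm]

theorem integrable_exp_neg_mul_norm_sq {d : ℕ} {r : ℝ} (hr : 0 < r) :
    Integrable fun z : Ed d => Real.exp (-r * ‖z‖ ^ 2) := by
  have h := (GaussianFourier.integrable_cexp_neg_mul_sq_norm_add (V := Ed d) (b := r)
    (by simpa using hr) 0 0).norm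
  refine h.congr (Eventually.of_forall fun z => ?_)
  simp [Complex.norm_exp, ← Complex.ofReal_pow]

/-- The integrand of `Fop` at time `t = s ^ 2` after the substitution `q₁ = q - s • z`. -/
def rescaledIntegrand {d : ℕ} (A : Ed d → Matrix (Fin d) (Fin d) ℝ) (b : Ed d → Ed d)
    (c : Ed d → ℝ) (τ : ℝ) (φ : Ed d → ℂ) (s : ℝ) (q z : Ed d) : ℂ :=
  (((4 * Real.pi) ^ (-(d : ℝ) / 2) * (A (q - ((1 - τ) * s) • z)).det ^ (-(1 : ℝ) / 2) *
    Real.exp (-(s ^ 2 * c (q - ((1 - τ) * s) • z))) *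
    Real.exp (-(quadF (A (q - ((1 - τ) * s) • z))⁻¹
      (z - s • b (q - ((1 - τ) * s) • z))) / 4) : ℝ) : ℂ) * φ (q - s • z)

theorem gker_sq_smul {d : ℕ} (A : Ed d → Matrix (Fin d) (Fin d) ℝ) (b : Ed d → Ed d)
    (c : Ed d → ℝ) {s : ℝ} (hs : 0 < s) (x z : Ed d) :
    s ^ d * gker A b c (s ^ 2) x (s • z) =
      (4 * Real.pi) ^ (-(d : ℝ) / 2) * (A x).det ^ (-(1 : ℝ) / 2) *
        Real.exp (-(s ^ 2 * c x)) * Real.exp (-(quadF (A x)⁻¹ (z - s • b x)) / 4) := by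
  have h1 : s • z - s ^ 2 • b x = s • (z - s • b x) := by rw [smul_sub, smul_smul, sq]
  have h2 : s ^ d * (4 * Real.pi * s ^ 2) ^ (-(d : ℝ) / 2) = (4 * Real.pi) ^ (-(d : ℝ) / 2) := by
    rw [Real.mul_rpow (by positivity) (by positivity), ← Real.rpow_natCast s 2,
      ← Real.rpow_mul hs.le, mul_left_comm, ← Real.rpow_natCast s d, ← Real.rpow_add hs]
    have : (d : ℝ) + ((2 : ℕ) : ℝ) * (-(d : ℝ) / 2) = 0 := by push_cast; ring
    rw [this, Real.rpow_zero, mul_one]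
  have h3 : -(s ^ 2 * quadF (A x)⁻¹ (z - s • b x)) / (4 * s ^ 2)
      = -(quadF (A x)⁻¹ (z - s • b x)) / 4 := by
    field_simp
  rw [gker, h1, quadF_smul, h3, ← h2]
  ring

theorem Fop_sq_eq_integral_of_pos {d : ℕ} (A : Ed d → Matrix (Fin d) (Fin d) ℝ) (b : Ed d → Ed d)
    (c : Ed d → ℝ) (τ : ℝ) (φ : Ed d → ℂ) {s : ℝ} (hs : 0 < s) (q : Ed d) :
    Fop A b c τ φ (s ^ 2) q = ∫ z, rescaledIntegrand A b c τ φ s q z := by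
  set f : Ed d → ℂ := fun q₁ =>
    ((gker A b c (s ^ 2) (τ • q + (1 - τ) • q₁) (q - q₁) : ℝ) : ℂ) * φ q₁ with hf
  have h1 : ∀ z, rescaledIntegrand A b c τ φ s q z = (s ^ d : ℝ) • f (q - s • z) := fun z => by
    have hx : τ • q + (1 - τ) • (q - s • z) = q - ((1 - τ) * s) • z := by module
    simp only [hf]
    rw [rescaledIntegrand, hx, sub_sub_cancel, ← gker_sq_smul A b c hs, Complex.real_smul]
    push_cast
    ring
  have h2 := Measure.integral_comp_smul (volume : Measure (Ed d)) (fun y => f (q - y)) s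
  rw [Fop, if_neg (by positivity), integral_congr_ae (Eventually.of_forall h1), integral_smul, h2,
    integral_sub_left_eq_self f volume q, smul_smul, finrank_euclideanSpace_fin,
    abs_of_pos (by positivity), mul_inv_cancel₀ (by positivity), one_smul]

theorem Fop_zero_eq_integral {d : ℕ} {A : Ed d → Matrix (Fin d) (Fin d) ℝ} (hA : ∀ x, (A x).PosDef)
    (b : Ed d → Ed d) (c : Ed d → ℝ) (τ : ℝ) (φ : Ed d → ℂ) (q : Ed d) :
    Fop A b c τ φ 0 q = ∫ z, rescaledIntegrand A b c τ φ 0 q z := by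
  simp only [Fop, rescaledIntegrand, if_true, mul_zero, zero_smul, sub_zero, ne_eq,
    OfNat.ofNat_ne_zero, not_false_eq_true, zero_pow, zero_mul, neg_zero, Real.exp_zero, mul_one]
  rw [integral_mul_const, integral_complex_ofReal, integral_const_mul,
    integral_exp_neg_quadF_inv (hA q), mul_mul_mul_comm,
    ← Real.rpow_add (by positivity), ← Real.rpow_add (hA q).det_pos]
  ring_nf
  simp

theorem continuous_rescaledIntegrand {d : ℕ} {A : Ed d → Matrix (Fin d) (Fin d) ℝ}
    (hA : Continuous A) (hdet : ∀ x, 0 < (A x).det) {b : Ed d → Ed d} (hb : Continuous b)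
    {c : Ed d → ℝ} (hc : Continuous c) (τ : ℝ) {φ : Ed d → ℂ} (hφ : Continuous φ) :
    Continuous fun p : ℝ × Ed d × Ed d => rescaledIntegrand A b c τ φ p.1 p.2.1 p.2.2 := by
  have hx : Continuous fun p : ℝ × Ed d × Ed d => p.2.1 - ((1 - τ) * p.1) • p.2.2 := by fun_prop
  have hinv : Continuous fun x => (A x)⁻¹ := by
    simp only [Matrix.inv_def, Ring.inverse_eq_inv']
    exact (hA.matrix_det.inv₀ fun x => (hdet x).ne').smul hA.matrix_adjugate
  have hdet' : Continuous fun x => (A x).det ^ (-(1 : ℝ) / 2) :=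
    hA.matrix_det.rpow_const fun x => Or.inl (hdet x).ne'
  have hquad : Continuous fun p : ℝ × Ed d × Ed d =>
      quadF (A (p.2.1 - ((1 - τ) * p.1) • p.2.2))⁻¹
        (p.2.2 - p.1 • b (p.2.1 - ((1 - τ) * p.1) • p.2.2)) := by
    have h1 : Continuous fun p : ℝ × Ed d × Ed d =>
        p.2.2 - p.1 • b (p.2.1 - ((1 - τ) * p.1) • p.2.2) := by fun_prop
    refine continuous_finsetSum _ fun i _ => continuous_finsetSum _ fun j _ => ?_
    exact (((PiLp.continuous_apply 2 _ i).comp h1).mul ((hinv.comp hx).matrix_elem i j)).mul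
      ((PiLp.continuous_apply 2 _ j).comp h1)
  refine (Complex.continuous_ofReal.comp
    (((continuous_const.mul (hdet'.comp hx)).mul ?_).mul ?_)).mul (by fun_prop)
  · exact Real.continuous_exp.comp (((continuous_fst.pow 2).mul (hc.comp hx)).neg)
  · exact Real.continuous_exp.comp (hquad.neg.div_const 4)

theorem exists_norm_le_mul_exp_neg_norm_sq {d : ℕ} {φ : Ed d → ℂ} (hφ : Continuous φ)
    (hφs : HasCompactSupport φ) (ε : ℝ) :
    ∃ C, 0 ≤ C ∧ ∀ x, ‖φ x‖ ≤ C * Real.exp (-ε * ‖x‖ ^ 2) := by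
  obtain ⟨C, hC⟩ := (hφs.smul_left (f := fun x => Real.exp (ε * ‖x‖ ^ 2))).exists_bound_of_continuous
    ((by fun_prop : Continuous fun x : Ed d => Real.exp (ε * ‖x‖ ^ 2)).smul hφ)
  refine ⟨C, (norm_nonneg _).trans (hC 0), fun x => ?_⟩
  have h := hC x
  simp only [Pi.smul_apply', norm_smul, Real.norm_eq_abs, Real.abs_exp] at h
  rwa [neg_mul, Real.exp_neg, ← div_eq_mul_inv, le_div_iff₀ (Real.exp_pos _), mul_comm]

theorem half_norm_sq_sub_le {E : Type*} [SeminormedAddCommGroup E] (x y : E) :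
    ‖x‖ ^ 2 / 2 - ‖y‖ ^ 2 ≤ ‖x - y‖ ^ 2 := by
  have h : ‖x‖ ≤ ‖x - y‖ + ‖y‖ := norm_le_norm_sub_add x y
  nlinarith [norm_nonneg x, sq_nonneg (‖x - y‖ - ‖y‖), norm_nonneg (x - y), norm_nonneg y]

theorem exists_norm_rescaledIntegrand_le {d : ℕ} {A : Ed d → Matrix (Fin d) (Fin d) ℝ}
    {b : Ed d → Ed d} {c : Ed d → ℝ} {τ : ℝ} {φ : Ed d → ℂ} {δ K B C S : ℝ} (hδ : 0 < δ)
    (hdet : ∀ x, δ ≤ (A x).det) (hK : 0 < K) (hquad : ∀ x v, ‖v‖ ^ 2 / K ≤ quadF (A x)⁻¹ v)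
    (hb : ∀ x, ‖b x‖ ≤ B) (hc : ∀ x, |c x| ≤ C) (hφ : Continuous φ) (hφs : HasCompactSupport φ)
    (hS : 0 < S) :
    ∃ f g : Ed d → ℝ, Integrable f ∧ Integrable g ∧
      ∀ s, |s| ≤ S → ∀ q z, ‖rescaledIntegrand A b c τ φ s q z‖ ≤ f q * g z := by
  set ε := 1 / (16 * K * S ^ 2) with hε
  have hε0 : 0 < ε := by positivity
  obtain ⟨D, hD0, hD⟩ := exists_norm_le_mul_exp_neg_norm_sq hφ hφs ε
  refine ⟨fun q => Real.exp (-(ε / 2) * ‖q‖ ^ 2),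
    fun z => (4 * Real.pi) ^ (-(d : ℝ) / 2) * δ ^ (-(1 : ℝ) / 2) * Real.exp (S ^ 2 * C) *
      Real.exp (S ^ 2 * B ^ 2 / (4 * K)) * D * Real.exp (-(1 / (16 * K)) * ‖z‖ ^ 2),
    integrable_exp_neg_mul_norm_sq (by positivity),
    (integrable_exp_neg_mul_norm_sq (by positivity)).const_mul _, fun s hs q z => ?_⟩
  rw [rescaledIntegrand]
  set x := q - ((1 - τ) * s) • z
  have hs2 : s ^ 2 ≤ S ^ 2 := sq_le_sq' (by linarith [(abs_le.1 hs).1]) (abs_le.1 hs).2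
  have hdx : 0 < (A x).det := hδ.trans_le (hdet x)
  have h1 : (A x).det ^ (-(1 : ℝ) / 2) ≤ δ ^ (-(1 : ℝ) / 2) :=
    Real.rpow_le_rpow_of_nonpos hδ (hdet x) (by norm_num)
  have h2 : -(s ^ 2 * c x) ≤ S ^ 2 * C := by
    have h0 : 0 ≤ C := (abs_nonneg _).trans (hc x)
    calc -(s ^ 2 * c x) ≤ s ^ 2 * |c x| := by
          rw [← mul_neg]; exact mul_le_mul_of_nonneg_left (neg_le_abs _) (sq_nonneg s)
      _ ≤ S ^ 2 * C := by gcongr; exact hc x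
  have h3 : -(quadF (A x)⁻¹ (z - s • b x)) / 4
      ≤ S ^ 2 * B ^ 2 / (4 * K) + -(1 / (8 * K)) * ‖z‖ ^ 2 := by
    have ha : ‖s • b x‖ ^ 2 ≤ S ^ 2 * B ^ 2 := by
      rw [norm_smul, mul_pow, Real.norm_eq_abs, sq_abs]
      gcongr
      exact hb x
    have hb' : (‖z‖ ^ 2 / 2 - S ^ 2 * B ^ 2) / K ≤ quadF (A x)⁻¹ (z - s • b x) := by
      refine le_trans ?_ (hquad x _)
      gcongr
      linarith [half_norm_sq_sub_le z (s • b x)]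
    have hc' : S ^ 2 * B ^ 2 / (4 * K) + -(1 / (8 * K)) * ‖z‖ ^ 2
        = -((‖z‖ ^ 2 / 2 - S ^ 2 * B ^ 2) / K) / 4 := by field_simp; ring
    linarith
  have h4 : -ε * ‖q - s • z‖ ^ 2 ≤ -(ε / 2) * ‖q‖ ^ 2 + 1 / (16 * K) * ‖z‖ ^ 2 := by
    have ha : ‖s • z‖ ^ 2 ≤ S ^ 2 * ‖z‖ ^ 2 := by
      rw [norm_smul, mul_pow, Real.norm_eq_abs, sq_abs]
      gcongr
    have hb' : ε * (S ^ 2 * ‖z‖ ^ 2) = 1 / (16 * K) * ‖z‖ ^ 2 := by rw [hε]; field_simp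
    have hc' := mul_le_mul_of_nonneg_left (half_norm_sq_sub_le q (s • z)) hε0.le
    have hd' := mul_le_mul_of_nonneg_left ha hε0.le
    linarith
  rw [norm_mul, Complex.norm_real, Real.norm_of_nonneg (by positivity)]
  calc _ ≤ (4 * Real.pi) ^ (-(d : ℝ) / 2) * δ ^ (-(1 : ℝ) / 2) * Real.exp (S ^ 2 * C) *
        Real.exp (S ^ 2 * B ^ 2 / (4 * K) + -(1 / (8 * K)) * ‖z‖ ^ 2) *
        (D * Real.exp (-(ε / 2) * ‖q‖ ^ 2 + 1 / (16 * K) * ‖z‖ ^ 2)) := by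
        gcongr
        exact (hD _).trans (by gcongr)
    _ = _ := by
        have h5 : -(1 / (16 * K)) * ‖z‖ ^ 2
            = -(1 / (8 * K)) * ‖z‖ ^ 2 + 1 / (16 * K) * ‖z‖ ^ 2 := by field_simp; ring
        beta_reduce
        rw [h5, Real.exp_add, Real.exp_add, Real.exp_add]
        ring

/-- `L¹`-continuity of a parametric integral whose integrand is jointly continuous and dominated,
locally uniformly in the parameter, by a product of integrable functions. -/
theorem tendsto_integral_norm_integral_sub {d : ℕ} {H : ℝ → Ed d → Ed d → ℂ}
    (hH : Continuous fun p : ℝ × Ed d × Ed d => H p.1 p.2.1 p.2.2) {f g : Ed d → ℝ}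
    (hf : Integrable f) (hg : Integrable g) {S s₀ : ℝ} (hs₀ : |s₀| < S)
    (hbound : ∀ s, |s| ≤ S → ∀ q z, ‖H s q z‖ ≤ f q * g z) :
    Tendsto (fun s => ∫ q, ‖(∫ z, H s q z) - ∫ z, H s₀ q z‖) (𝓝 s₀) (𝓝 0) := by
  have hev : ∀ᶠ s in 𝓝 s₀, |s| ≤ S :=
    (continuous_abs.continuousAt.eventually (Iio_mem_nhds hs₀)).mono fun s hs => le_of_lt hs
  have hinner : ∀ s, |s| ≤ S → ∀ q, ‖∫ z, H s q z‖ ≤ f q * ∫ z, g z := fun s hs q => by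
    rw [← integral_const_mul]
    exact norm_integral_le_of_norm_le (hg.const_mul _) (Eventually.of_forall (hbound s hs q))
  have hmeas : ∀ s, AEStronglyMeasurable (fun q => ∫ z, H s q z) := fun s =>
    (StronglyMeasurable.integral_prod_right (f := H s)
      (hH.comp (Continuous.prodMk_right s)).stronglyMeasurable).aestronglyMeasurable
  have hlim : ∀ q, Tendsto (fun s => ∫ z, H s q z) (𝓝 s₀) (𝓝 (∫ z, H s₀ q z)) := fun q =>
    tendsto_integral_filter_of_dominated_convergence (fun z => f q * g z)
      (Eventually.of_forall fun s =>
        (hH.comp (by fun_prop : Continuous fun z => (s, q, z))).aestronglyMeasurable)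
      (hev.mono fun s hs => Eventually.of_forall (hbound s hs q)) (hg.const_mul _)
      (Eventually.of_forall fun z =>
        (hH.comp (by fun_prop : Continuous fun s => (s, q, z))).tendsto s₀)
  have h := tendsto_integral_filter_of_dominated_convergence (μ := (volume : Measure (Ed d)))
    (l := 𝓝 s₀) (F := fun s q => ‖(∫ z, H s q z) - ∫ z, H s₀ q z‖) (f := fun _ => (0 : ℝ))
    (fun q => f q * (∫ z, g z) + f q * ∫ z, g z)
    (Eventually.of_forall fun s => ((hmeas s).sub (hmeas s₀)).norm)
    (hev.mono fun s hs => Eventually.of_forall fun q => by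
      rw [norm_norm]
      exact (norm_sub_le _ _).trans (add_le_add (hinner s hs q) (hinner s₀ hs₀.le q)))
    ((hf.mul_const _).add (hf.mul_const _))
    (Eventually.of_forall fun q => by
      simpa using ((hlim q).sub_const (∫ z, H s₀ q z)).norm)
  simpa using h

/-- Strong `L¹`-continuity in `t ≥ 0` of the family `F_τ(t)` on test functions:
`‖F_τ(t)φ − F_τ(t₀)φ‖_{L¹} → 0` as `t → t₀`, `t ≥ 0`. -/
theorem statement10 {d : ℕ} (hd : 1 ≤ d) (τ : ℝ) (hτ : τ ∈ Set.Icc (0 : ℝ) 1)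
    (A : Ed d → Matrix (Fin d) (Fin d) ℝ) (hAsymm : ∀ q, (A q).IsSymm)
    (b : Ed d → Ed d) (c : Ed d → ℝ)
    (hA4 : ∀ i j, ContDiff ℝ 4 (fun q : Ed d => A q i j))
    (hA4b : ∀ i j, ∀ n : ℕ, n ≤ 4 →
      ∃ C : ℝ, ∀ q : Ed d, ‖iteratedFDeriv ℝ n (fun q : Ed d => A q i j) q‖ ≤ C)
    (hb4 : ContDiff ℝ 4 b)
    (hb4b : ∀ n : ℕ, n ≤ 4 → ∃ C : ℝ, ∀ q : Ed d, ‖iteratedFDeriv ℝ n b q‖ ≤ C)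
    (hc4 : ContDiff ℝ 4 c)
    (hc4b : ∀ n : ℕ, n ≤ 4 → ∃ C : ℝ, ∀ q : Ed d, ‖iteratedFDeriv ℝ n c q‖ ≤ C)
    (a₀ A₀ : ℝ) (ha₀ : 0 < a₀) (ha₀A₀ : a₀ ≤ A₀)
    (hell : ∀ q p : Ed d, a₀ * ‖p‖ ^ 2 ≤ quadF (A q) p ∧ quadF (A q) p ≤ A₀ * ‖p‖ ^ 2)
    (φ : Ed d → ℂ) (hφsmooth : ContDiff ℝ (⊤ : ℕ∞) φ) (hφsupp : HasCompactSupport φ)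
    (t₀ : ℝ) (ht₀ : 0 ≤ t₀) :
    Tendsto (fun t : ℝ => ∫ q : Ed d, ‖Fop A b c τ φ t q - Fop A b c τ φ t₀ q‖)
      (𝓝[Set.Ici 0] t₀) (𝓝 0) := by
  have hpos : ∀ x, (A x).PosDef := fun x => posDef_of_quadF (hAsymm x) ha₀ fun p => (hell x p).1
  have hA : Continuous A := continuous_matrix fun i j => (hA4 i j).continuous
  obtain ⟨B, hB⟩ := hb4b 0 (by norm_num)
  obtain ⟨C, hC⟩ := hc4b 0 (by norm_num)
  simp only [norm_iteratedFDeriv_zero] at hB hC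
  have hK : 0 < A₀ := ha₀.trans_le ha₀A₀
  obtain ⟨f, g, hf, hg, hfg⟩ := exists_norm_rescaledIntegrand_le (τ := τ) (pow_pos ha₀ d)
    (fun x => pow_le_det_of_quadF (hAsymm x) ha₀ fun p => (hell x p).1) hK
    (fun x => norm_sq_div_le_quadF_inv (hpos x) hK fun p => (hell x p).2) hB hC
    hφsmooth.continuous hφsupp (S := √t₀ + 1) (by positivity)
  have hlim := tendsto_integral_norm_integral_sub (s₀ := √t₀)
    (continuous_rescaledIntegrand hA (fun x => (hpos x).det_pos) hb4.continuous hc4.continuous τ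
      hφsmooth.continuous) hf hg (by rw [abs_of_nonneg (Real.sqrt_nonneg _)]; linarith) hfg
  have hFop : ∀ t, 0 ≤ t → ∀ q,
      Fop A b c τ φ t q = ∫ z, rescaledIntegrand A b c τ φ (√t) q z := fun t ht q => by
    rcases ht.eq_or_lt with rfl | ht
    · rw [Real.sqrt_zero, Fop_zero_eq_integral hpos]
    · rw [← Fop_sq_eq_integral_of_pos A b c τ φ (Real.sqrt_pos.2 ht), Real.sq_sqrt ht.le]
  refine ((hlim.comp (Real.continuous_sqrt.tendsto t₀)).mono_left nhdsWithin_le_nhds).congr' ?_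
  filter_upwards [self_mem_nhdsWithin] with t ht
  simp only [Function.comp_apply, hFop t ht, hFop t₀ ht₀]
end
end
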